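/- Let G : ℝ^n → ℝ be continuously differentiable and y* ∈ ℝ a fixed point of h(y) := y + G(ye) with |h'(y*)| < 1, where h'(y*) = 1 + DG(y*e)e and DG denotes the derivative (gradient, as a row vector) of G. Let T = [e v_2 … v_n] be an invertible matrix whose first column is e = (1,…,1)^T and whose remaining columns span e^⊥ = {x ∈ ℝ^n : e^T x = 0}. Then for every row stochastic matrix P, the matrix T^{-1}(P + e·DG(y*e))T is block upper triangular of the form [[λ, c̃],[0, Q]], where λ = 1 + DG(y*e)e = h'(y*) satisfies |λ| < 1 and Q is the lower-right (n−1)×(n−1) block of T^{-1}PT. -/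

import Mathlib

/-- A matrix is row stochastic if all entries are nonnegative and every row sums to one. -/
def RowStochastic {n : ℕ} (P : Matrix (Fin n) (Fin n) ℝ) : Prop :=
  (∀ i j, 0 ≤ P i j) ∧ ∀ i, ∑ j, P i j = 1

namespace Matrix

/-- If the column `j` of an invertible matrix `T` is `v`, then `T⁻¹ v` is the `j`-th unit vector. -/
theorem inv_mulVec_eq_single {ι R : Type*} [Fintype ι] [DecidableEq ι] [CommRing R]
    {T : Matrix ι ι R} (hT : IsUnit T) {j : ι} {v : ι → R} (hv : T.col j = v) :
    T⁻¹ *ᵥ v = Pi.single j 1 := by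
  rw [← hv, ← mulVec_single_one, mulVec_mulVec,
    nonsing_inv_mul _ ((isUnit_iff_isUnit_det T).mp hT), one_mulVec]

/-- Conjugating a matrix by `T` turns an eigenvector with eigenvalue one in the column `j` of `T`
into the `j`-th unit vector in the column `j`. -/
theorem col_inv_mul_mul_eq_single {ι R : Type*} [Fintype ι] [DecidableEq ι] [CommRing R]
    {P T : Matrix ι ι R} (hT : IsUnit T) {j : ι} (hP : P *ᵥ T.col j = T.col j) :
    (T⁻¹ * P * T).col j = Pi.single j 1 := by
  rw [← mulVec_single_one, ← mulVec_mulVec, ← mulVec_mulVec, mulVec_single_one, hP,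
    inv_mulVec_eq_single hT rfl]

end Matrix

/-- A linear functional on `ι → R` is given by the dot product with its values on the unit
vectors. -/
theorem LinearMap.dotProduct_apply_single {ι R : Type*} [Fintype ι] [DecidableEq ι]
    [CommSemiring R] (L : (ι → R) →ₗ[R] R) (v : ι → R) :
    (fun i => L (Pi.single i 1)) ⬝ᵥ v = L v := by
  rw [L.pi_apply_eq_sum_univ v, dotProduct]
  refine Finset.sum_congr rfl fun i _ => ?_
  rw [smul_eq_mul, mul_comm]
  congr 2
  ext k
  simp [Pi.single_apply, eq_comm]

/-- if `T = [e v₂ … vₙ]` is invertible with first column `e` and remaining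
columns in `e^⊥`, and `y*` is a fixed point of `h(y) = y + G(ye)` with `|h'(y*)| < 1`
(where `h'(y*) = 1 + DG(y*e)e`), then for every row stochastic `P` the matrix
`A = T⁻¹(P + e·DG(y*e))T` is block upper triangular `[[λ, c̃],[0, Q]]` with
`λ = 1 + DG(y*e)e = h'(y*)`, `|λ| < 1`, and `Q` equal to the lower-right block of
`T⁻¹PT`. -/
theorem stmt6 {n : ℕ} [NeZero n]
    (G : (Fin n → ℝ) → ℝ) (hG : ContDiff ℝ 1 G)
    (ystar : ℝ) (hfix : ystar + G (fun _ => ystar) = ystar)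
    (hcontract : |1 + fderiv ℝ G (fun _ => ystar) (fun _ => 1)| < 1) :
    ∀ P : Matrix (Fin n) (Fin n) ℝ, RowStochastic P →
      ∀ T : Matrix (Fin n) (Fin n) ℝ, IsUnit T →
        (∀ i, T i 0 = 1) → (∀ j : Fin n, j ≠ 0 → ∑ i, T i j = 0) →
        ∀ A : Matrix (Fin n) (Fin n) ℝ,
          A = T⁻¹ * (P + Matrix.of (fun (_ : Fin n) (j : Fin n) =>
                fderiv ℝ G (fun _ => ystar) (Pi.single j (1 : ℝ)))) * T →
          (A 0 0 = 1 + fderiv ℝ G (fun _ => ystar) (fun _ => 1) ∧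
            |A 0 0| < 1 ∧
            (∀ i : Fin n, i ≠ 0 → A i 0 = 0) ∧
            (∀ i j : Fin n, i ≠ 0 → j ≠ 0 → A i j = (T⁻¹ * P * T) i j)) := by
  intro P hP T hT hcol _ A hA
  set L := fderiv ℝ G (fun _ => ystar)
  let d : Fin n → ℝ := fun j => L (Pi.single j 1)
  have hT0 : T.col 0 = fun _ => 1 := funext hcol
  have hPT : P.mulVec (T.col 0) = T.col 0 := by
    rw [hT0]
    ext i
    simpa [Matrix.mulVec, dotProduct] using hP.2 i
  have hdecomp : A = T⁻¹ * P * T +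
      Matrix.vecMulVec (Pi.single 0 1) (Matrix.vecMul d T) := by
    have hrank : Matrix.of (fun (_ : Fin n) (j : Fin n) => L (Pi.single j (1 : ℝ))) =
        Matrix.vecMulVec (fun _ => 1) d := by
      ext i j
      simp [Matrix.vecMulVec_apply, d]
    rw [hA, hrank, mul_add, add_mul, Matrix.mul_vecMulVec, Matrix.vecMulVec_mul,
      Matrix.inv_mulVec_eq_single hT hT0]
  have hconj (i : Fin n) : (T⁻¹ * P * T) i 0 = (Pi.single 0 1 : Fin n → ℝ) i :=
    congrFun (Matrix.col_inv_mul_mul_eq_single hT hPT) i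
  have hd : Matrix.vecMul d T 0 = L (fun _ => 1) := by
    rw [← hT0]
    exact L.toLinearMap.dotProduct_apply_single (T.col 0)
  have h00 : A 0 0 = 1 + L (fun _ => 1) := by
    rw [hdecomp, Matrix.add_apply, hconj, Matrix.vecMulVec_apply, hd]
    simp
  refine ⟨h00, h00 ▸ hcontract, fun i hi => ?_, fun i j hi _ => ?_⟩
  · rw [hdecomp, Matrix.add_apply, hconj, Matrix.vecMulVec_apply]
    simp [hi]
  · rw [hdecomp, Matrix.add_apply, Matrix.vecMulVec_apply]
    simp [hi]
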